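/- arXiv:2504.12601 — 2 statements merged into one kernel-verified Lean document; each statement's English description precedes it below -/
import Mathlib

section
/- Let f : ℝ^d → ℝ be d-times continuously differentiable, bounded below with f(θ) ≥ f* for all θ, coercive (f(θ) → +∞ as ‖θ‖ → +∞), and suppose there exist η > 0 and D_η > 0 with {θ : ‖∇f(θ)‖ < η} ⊆ {θ : f(θ) − f* < D_η}. Then for every nonempty open interval (u, v) ⊆ ℝ there exist h₁ < h₂ with [h₁, h₂] ⊆ (u, v), [h₁, h₂] ∩ f(Crit(f)) = ∅, and, if f⁻¹([h₁, h₂]) is nonempty, inf{‖∇f(θ)‖ : θ ∈ f⁻¹([h₁, h₂])} > 0. -/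
open Filter

open MeasureTheory Module Set
open scoped Topology ContDiff ENNReal NNReal

/-- If `f` satisfies the Hölder condition of exponent `r` at small scales on `s`, then it maps `s`
to a set whose one-dimensional Hausdorff measure is controlled by `μH[r] s`. -/
theorem hausdorffMeasure_one_image_le_of_dist_lt {X Y : Type*} [MetricSpace X]
    [TopologicalSpace.SeparableSpace X] [MeasurableSpace X] [BorelSpace X] [MetricSpace Y]
    [MeasurableSpace Y] [BorelSpace Y] {f : X → Y} {s : Set X} {C r : ℝ≥0} {δ : ℝ} (hr : 0 < r)
    (hδ : 0 < δ) (h : ∀ x ∈ s, ∀ y ∈ s, dist x y < δ →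
      edist (f x) (f y) ≤ C * edist x y ^ (r : ℝ)) :
    μH[1] (f '' s) ≤ C * μH[r] s := by
  rcases isEmpty_or_nonempty X with hX | hX
  · simp [Set.eq_empty_of_isEmpty s]
  set P : ℕ → Set X :=
    disjointed fun n ↦ Metric.ball (TopologicalSpace.denseSeq X n) (δ / 2)
  have hP_meas : ∀ n, MeasurableSet (P n) := fun n ↦
    MeasurableSet.disjointed (fun _ ↦ measurableSet_ball) n
  have hP_univ : ⋃ n, P n = univ := by
    rw [iUnion_disjointed, eq_univ_iff_forall]
    intro x
    obtain ⟨n, hn⟩ := (TopologicalSpace.denseRange_denseSeq X).exists_dist_lt x (half_pos hδ)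
    exact mem_iUnion.2 ⟨n, hn⟩
  have hP_image : ∀ n, μH[1] (f '' (s ∩ P n)) ≤ C * μH[r] (s ∩ P n) := by
    intro n
    have hholder : HolderOnWith C r f (s ∩ P n) := by
      intro x hx y hy
      have hx' := Metric.mem_ball.1 (disjointed_subset _ n hx.2)
      have hy' := Metric.mem_ball.1 (disjointed_subset _ n hy.2)
      have := dist_triangle_right x y (TopologicalSpace.denseSeq X n)
      exact h x hx.1 y hy.1 (by linarith)
    simpa using hholder.hausdorffMeasure_image_le hr zero_le_one
  calc μH[1] (f '' s) = μH[1] (⋃ n, f '' (s ∩ P n)) := by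
        rw [← image_iUnion, ← inter_iUnion, hP_univ, inter_univ]
    _ ≤ ∑' n, μH[1] (f '' (s ∩ P n)) := measure_iUnion_le _
    _ ≤ ∑' n, C * μH[r] (s ∩ P n) := ENNReal.tsum_le_tsum hP_image
    _ = C * ∑' n, (μH[r] : Measure X).restrict s (P n) := by
        rw [ENNReal.tsum_mul_left]
        simp_rw [Measure.restrict_apply (hP_meas _), inter_comm s]
    _ = C * μH[r] s := by
        rw [← measure_iUnion (disjoint_disjointed _) hP_meas, hP_univ,
          Measure.restrict_apply_univ]

/-- A function on a space of dimension at most `k` maps a set of points at which it is constant up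
to `o(‖y - x‖ ^ k)` to a null set. -/
theorem volume_image_eq_zero_of_isLittleO_pow {K : Type*} [NormedAddCommGroup K] [NormedSpace ℝ K]
    [FiniteDimensional ℝ K] {k : ℕ} (hk : 0 < k) (hK : finrank ℝ K ≤ k) {f : K → ℝ} {B : Set K}
    (hf : ∀ x ∈ B, (fun y ↦ f y - f x) =o[𝓝 x] fun y ↦ ‖y - x‖ ^ k) :
    volume (f '' B) = 0 := by
  borelize K
  rw [← hausdorffMeasure_real]
  have hfin : ∀ R : ℕ, (μH[(k : ℝ≥0)] : Measure K) (Metric.closedBall 0 R) ≠ ⊤ := by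
    intro R
    refine ((Measure.hausdorffMeasure_mono (d₁ := finrank ℝ K) ?_ _).trans_lt
      (isCompact_closedBall (0 : K) R).measure_lt_top).ne
    simpa using hK
  have hball : ∀ (R : ℕ) (ε : ℝ≥0), 0 < ε →
      μH[1] (f '' (B ∩ Metric.closedBall 0 R)) ≤
        ε * (μH[(k : ℝ≥0)] : Measure K) (Metric.closedBall 0 R) := by
    intro R ε hε
    set T : ℕ → Set K := fun N ↦ {x ∈ B ∩ Metric.closedBall 0 R |
      ∀ y, dist y x < 1 / (N + 1 : ℝ) → ‖f y - f x‖ ≤ ε * ‖y - x‖ ^ k}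
    have hT_mono : Monotone T := fun M N hMN x hx ↦
      ⟨hx.1, fun y hy ↦ hx.2 y (hy.trans_le (Nat.one_div_le_one_div hMN))⟩
    have hT_union : B ∩ Metric.closedBall 0 R ⊆ ⋃ N, T N := by
      intro x hx
      obtain ⟨δ, hδ, hδ'⟩ := Metric.eventually_nhds_iff.1 ((hf x hx.1).def (c := ε) hε)
      obtain ⟨N, hN⟩ := exists_nat_one_div_lt hδ
      refine mem_iUnion.2 ⟨N, hx, fun y hy ↦ ?_⟩
      simpa using hδ' (hy.trans hN)
    calc μH[1] (f '' (B ∩ Metric.closedBall 0 R)) ≤ μH[1] (⋃ N, f '' T N) := by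
          rw [← image_iUnion]; exact measure_mono (image_mono hT_union)
      _ = ⨆ N, μH[1] (f '' T N) := Monotone.measure_iUnion fun M N h ↦ image_mono (hT_mono h)
      _ ≤ ε * (μH[(k : ℝ≥0)] : Measure K) (Metric.closedBall 0 R) := by
          refine iSup_le fun N ↦ (hausdorffMeasure_one_image_le_of_dist_lt (C := ε) (r := k)
            (δ := 1 / (N + 1 : ℝ)) (by exact_mod_cast hk) (by positivity) ?_).trans ?_
          · intro x _ y hy hxy
            have := hy.2 x hxy
            rw [edist_dist, edist_dist, dist_eq_norm, dist_eq_norm,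
              ← ENNReal.ofReal_coe_nnreal, NNReal.coe_natCast, ENNReal.rpow_natCast,
              ← ENNReal.ofReal_pow (norm_nonneg _), ← ENNReal.ofReal_mul ε.coe_nonneg]
            exact ENNReal.ofReal_le_ofReal this
          · gcongr
            exact fun x hx ↦ hx.1.2
  have hnull : ∀ R : ℕ, μH[1] (f '' (B ∩ Metric.closedBall 0 R)) = 0 := by
    intro R
    have hlim : Tendsto (fun ε : ℝ≥0 ↦
        (ε : ℝ≥0∞) * (μH[(k : ℝ≥0)] : Measure K) (Metric.closedBall 0 R)) (𝓝[>] 0) (𝓝 0) := by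
      have := ENNReal.Tendsto.mul_const (f := 𝓝[>] (0 : ℝ≥0))
        (b := (μH[(k : ℝ≥0)] : Measure K) (Metric.closedBall 0 R))
        ((ENNReal.continuous_coe.tendsto (0 : ℝ≥0)).mono_left nhdsWithin_le_nhds)
        (Or.inr (hfin R))
      simpa using this
    exact le_antisymm (ge_of_tendsto hlim
      (eventually_mem_nhdsWithin.mono fun ε hε ↦ hball R ε hε)) zero_le
  refine measure_mono_null ?_ (measure_iUnion_null hnull)
  rw [← image_iUnion, ← inter_iUnion, Metric.iUnion_closedBall_nat, inter_univ]

/-- If the derivative of `g` along `ψ` is `o(‖y - x‖ ^ k)`, then `g ∘ ψ` is constant up to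
`o(‖y - x‖ ^ (k + 1))`. -/
theorem isLittleO_comp_sub_pow_succ {K E F : Type*} [NormedAddCommGroup K] [NormedSpace ℝ K]
    [NormedAddCommGroup E] [NormedSpace ℝ E] [NormedAddCommGroup F] [NormedSpace ℝ F]
    {ψ : K → E} {g : E → F} {x : K} {k : ℕ} (hψ : ContDiffAt ℝ 1 ψ x)
    (hg : ContDiffAt ℝ 1 g (ψ x))
    (h : (fun y ↦ fderiv ℝ g (ψ y)) =o[𝓝 x] fun y ↦ ‖y - x‖ ^ k) :
    (fun y ↦ g (ψ y) - g (ψ x)) =o[𝓝 x] fun y ↦ ‖y - x‖ ^ (k + 1) := by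
  have hdiff : ∀ᶠ y in 𝓝 x, HasFDerivAt (g ∘ ψ) ((fderiv ℝ g (ψ y)).comp (fderiv ℝ ψ y)) y := by
    filter_upwards [hψ.eventually (by simp), hψ.continuousAt.eventually (hg.eventually (by simp))]
      with y hy hy'
    exact (hy'.differentiableAt one_ne_zero).hasFDerivAt.comp y
      (hy.differentiableAt one_ne_zero).hasFDerivAt
  have hbound : (fun y ↦ fderiv ℝ ψ y) =O[𝓝 x] fun _ ↦ (1 : ℝ) :=
    (hψ.continuousAt_fderiv one_ne_zero).isBigO_one ℝ
  have hderiv : (fun y ↦ (fderiv ℝ g (ψ y)).comp (fderiv ℝ ψ y)) =o[𝓝 x]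
      fun y ↦ ‖y - x‖ ^ k := by
    have hprod : (fun y ↦ ‖fderiv ℝ g (ψ y)‖ * ‖fderiv ℝ ψ y‖) =o[𝓝 x]
        fun y ↦ ‖y - x‖ ^ k * 1 := h.norm_left.mul_isBigO hbound.norm_left
    simp only [mul_one] at hprod
    exact (Asymptotics.IsBigO.of_norm_le fun y ↦
      ContinuousLinearMap.opNorm_comp_le _ _).trans_isLittleO hprod
  obtain ⟨δ, hδ, hball⟩ := Metric.eventually_nhds_iff_ball.1 hdiff
  have := (convex_ball x δ).isLittleO_pow_succ (Metric.mem_ball_self hδ)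
    (fun y hy ↦ (hball y hy).hasFDerivWithinAt) (hderiv.mono nhdsWithin_le_nhds)
  rwa [nhdsWithin_eq_nhds.2 (Metric.ball_mem_nhds x hδ)] at this

section FlatParametrization

variable {E : Type} [NormedAddCommGroup E] [NormedSpace ℝ E]

/-- The set `s` is the image of a subset `B` of a space of dimension at most `dim E` under a map
`ψ` which is `C¹` at the points of `B`, in such a way that each function `g` that is `C^k` along `A`
and vanishes on `A` satisfies `g (ψ y) = o(‖y - x‖ ^ k)` at each `x ∈ B`. -/
def HasFlatParametrization (k : ℕ) (A s : Set E) : Prop :=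
  ∃ (K : Type) (_ : NormedAddCommGroup K) (_ : NormedSpace ℝ K) (_ : FiniteDimensional ℝ K)
    (ψ : K → E) (B : Set K), finrank ℝ K ≤ finrank ℝ E ∧ s ⊆ ψ '' B ∧
      (∀ x ∈ B, ψ x ∈ A ∧ ContDiffAt ℝ 1 ψ x) ∧
      ∀ (F : Type) [NormedAddCommGroup F] [NormedSpace ℝ F] (g : E → F),
        (∀ y ∈ A, ContDiffAt ℝ k g y ∧ g y = 0) →
          ∀ x ∈ B, (fun y ↦ g (ψ y)) =o[𝓝 x] fun y ↦ ‖y - x‖ ^ k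

/-- The set `s` is covered by countably many sets with a flat parametrization. -/
def HasFlatCover (k : ℕ) (A s : Set E) : Prop :=
  ∃ S : Set (Set E), S.Countable ∧ s ⊆ ⋃₀ S ∧ ∀ t ∈ S, HasFlatParametrization k A t

theorem HasFlatCover.mono {k : ℕ} {A s t : Set E} (h : HasFlatCover k A t) (hst : s ⊆ t) :
    HasFlatCover k A s :=
  let ⟨S, hS, htS, hflat⟩ := h
  ⟨S, hS, hst.trans htS, hflat⟩

theorem HasFlatCover.sUnion {k : ℕ} {A : Set E} {T : Set (Set E)} (hT : T.Countable)
    (h : ∀ t ∈ T, HasFlatCover k A t) : HasFlatCover k A (⋃₀ T) := by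
  choose! S hS hcover hflat using h
  refine ⟨⋃ t ∈ T, S t, hT.biUnion hS, ?_, ?_⟩
  · rintro x ⟨t, ht, hxt⟩
    obtain ⟨u, hu, hxu⟩ := hcover t ht hxt
    exact ⟨u, mem_biUnion ht hu, hxu⟩
  · intro u hu
    obtain ⟨t, ht, hut⟩ := mem_iUnion₂.1 hu
    exact hflat t ht u hut

theorem HasFlatCover.union {k : ℕ} {A s t : Set E} (hs : HasFlatCover k A s)
    (ht : HasFlatCover k A t) : HasFlatCover k A (s ∪ t) := by
  rw [← sUnion_pair]
  refine HasFlatCover.sUnion (by simp) ?_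
  rintro u (rfl | rfl) <;> assumption

theorem HasFlatParametrization.image {K : Type} [NormedAddCommGroup K] [NormedSpace ℝ K] {k : ℕ}
    (hk : k ≠ 0) (hKE : finrank ℝ K ≤ finrank ℝ E) {A : Set E} {A' s : Set K} {φ : K → E}
    (hφ : ∀ x ∈ A', φ x ∈ A ∧ ContDiffAt ℝ k φ x) (h : HasFlatParametrization k A' s) :
    HasFlatParametrization k A (φ '' s) := by
  obtain ⟨L, _, _, _, ψ, B, hL, hs, hψ, hflat⟩ := h
  refine ⟨L, inferInstance, inferInstance, inferInstance, φ ∘ ψ, B, hL.trans hKE, ?_, ?_, ?_⟩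
  · rw [image_comp]
    exact image_mono hs
  · intro x hx
    obtain ⟨hxA, hψx⟩ := hψ x hx
    refine ⟨(hφ _ hxA).1, ((hφ _ hxA).2.of_le ?_).comp x hψx⟩
    exact_mod_cast Nat.one_le_iff_ne_zero.2 hk
  · intro F _ _ g hg
    refine hflat F (g ∘ φ) fun y hy ↦ ⟨?_, (hg _ (hφ y hy).1).2⟩
    exact (hg _ (hφ y hy).1).1.comp y (hφ y hy).2

theorem HasFlatCover.image {K : Type} [NormedAddCommGroup K] [NormedSpace ℝ K] {k : ℕ}
    (hk : k ≠ 0) (hKE : finrank ℝ K ≤ finrank ℝ E) {A : Set E} {A' s : Set K} {φ : K → E}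
    (hφ : ∀ x ∈ A', φ x ∈ A ∧ ContDiffAt ℝ k φ x) (h : HasFlatCover k A' s) :
    HasFlatCover k A (φ '' s) := by
  obtain ⟨S, hS, hs, hflat⟩ := h
  refine ⟨(φ '' ·) '' S, hS.image _, ?_, forall_mem_image.2 fun t ht ↦ (hflat t ht).image hk hKE hφ⟩
  rintro _ ⟨x, hx, rfl⟩
  obtain ⟨t, ht, hxt⟩ := hs hx
  exact ⟨φ '' t, mem_image_of_mem _ ht, mem_image_of_mem _ hxt⟩

/-- On the part `A'` of `A` at which the derivative of every `C^(k+1)` function vanishing on `A`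
is zero, flatness of order `k` improves to flatness of order `k + 1`. -/
theorem HasFlatParametrization.succ {k : ℕ} {A A' s : Set E} (hA : A' ⊆ A)
    (hderiv : ∀ h : E → ℝ, (∀ y ∈ A, ContDiffAt ℝ (k + 1 : ℕ) h y ∧ h y = 0) →
      ∀ x ∈ A', fderiv ℝ h x = 0)
    (h : HasFlatParametrization k A' s) : HasFlatParametrization (k + 1) A s := by
  obtain ⟨K, _, _, _, ψ, B, hK, hs, hψ, hflat⟩ := h
  refine ⟨K, inferInstance, inferInstance, inferInstance, ψ, B, hK, hs,
    fun x hx ↦ ⟨hA (hψ x hx).1, (hψ x hx).2⟩, fun F _ _ g hg x hx ↦ ?_⟩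
  have hfderiv : ∀ y ∈ A', ContDiffAt ℝ k (fderiv ℝ g) y ∧ fderiv ℝ g y = 0 := by
    intro y hy
    have hgy := (hg y (hA hy)).1
    refine ⟨hgy.fderiv_right (by norm_cast), ?_⟩
    ext v
    refine SeparatingDual.eq_zero_of_forall_dual_eq_zero (R := ℝ) fun ℓ ↦ ?_
    have hℓ := hderiv (fun z ↦ ℓ (g z)) (fun z hz ↦
      ⟨ℓ.contDiff.contDiffAt.comp z (hg z hz).1, by simp [(hg z hz).2]⟩) y hy
    have hcomp := ℓ.hasFDerivAt.comp y (hgy.differentiableAt (by simp)).hasFDerivAt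
    have := hcomp.fderiv.symm.trans hℓ
    simpa using DFunLike.congr_fun this v
  have hxA := hA (hψ x hx).1
  have := isLittleO_comp_sub_pow_succ (hψ x hx).2 ((hg _ hxA).1.of_le (by norm_cast; omega))
    (hflat _ (fderiv ℝ g) hfderiv x hx)
  simpa [(hg _ hxA).2] using this

theorem HasFlatCover.succ {k : ℕ} {A A' s : Set E} (hA : A' ⊆ A)
    (hderiv : ∀ h : E → ℝ, (∀ y ∈ A, ContDiffAt ℝ (k + 1 : ℕ) h y ∧ h y = 0) →
      ∀ x ∈ A', fderiv ℝ h x = 0)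
    (h : HasFlatCover k A' s) : HasFlatCover (k + 1) A s :=
  let ⟨S, hS, hs, hflat⟩ := h
  ⟨S, hS, hs, fun t ht ↦ (hflat t ht).succ hA hderiv⟩

end FlatParametrization

/-- Near a regular point, the zero set of a `C^k` function is parametrized by a `C^k` map defined on
the kernel of the derivative. -/
theorem exists_local_parametrization_of_fderiv_ne_zero {E : Type*} [NormedAddCommGroup E]
    [NormedSpace ℝ E] [FiniteDimensional ℝ E] {k : ℕ} (hk : k ≠ 0) {h : E → ℝ} {a : E}
    (hh : ContDiffAt ℝ k h a) (hda : fderiv ℝ h a ≠ 0) :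
    ∃ (φ : (fderiv ℝ h a).ker → E) (p : E → (fderiv ℝ h a).ker),
      ∀ᶠ x in 𝓝 a, h x = 0 → φ (p x) = x ∧ ContDiffAt ℝ k φ (p x) := by
  have hk' : (k : ℕ∞ω) ≠ 0 := by exact_mod_cast hk
  have hrange : (fderiv ℝ h a).range = ⊤ :=
    LinearMap.range_eq_top.2 (LinearMap.surjective (by exact_mod_cast hda))
  have hker : (fderiv ℝ h a).ker.ClosedComplemented :=
    Submodule.ClosedComplemented.of_finiteDimensional _
  set D := (hh.hasStrictFDerivAt hk').implicitFunctionDataOfComplemented h (fderiv ℝ h a)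
    hrange hker
  have hright : ContDiff ℝ k D.rightFun :=
    (Classical.choose hker).contDiff.comp (contDiff_id.sub contDiff_const)
  have hsmooth : ContDiffAt ℝ k D.implicitFunction.uncurry (D.prodFun D.pt) :=
    D.contDiffAt_implicitFunction hh hright.contDiffAt hk'
  refine ⟨D.implicitFunction 0, D.rightFun, ?_⟩
  have hcont : ContinuousAt D.prodFun a := D.hasStrictFDerivAt.continuousAt
  filter_upwards [D.implicitFunction_apply_image, hcont.eventually (hsmooth.eventually (by simp))]
    with x hx hx' hx0
  have hleft : D.leftFun x = 0 := hx0
  refine ⟨by rwa [hleft] at hx, ?_⟩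
  have hpair : D.prodFun x = (0, D.rightFun x) := Prod.ext hleft rfl
  rw [hpair] at hx'
  exact hx'.comp (D.rightFun x) (contDiffAt_const.prodMk contDiffAt_id)

/-- **A. P. Morse's decomposition**: every set `A` is covered by countably many `C¹` pieces along
which all `C^k` functions vanishing on `A` are flat of order `k`. -/
theorem hasFlatCover_self {E : Type} [NormedAddCommGroup E] [NormedSpace ℝ E]
    [FiniteDimensional ℝ E] (k : ℕ) (A : Set E) : HasFlatCover k A A := by
  obtain ⟨n, hn⟩ : ∃ n, finrank ℝ E = n := ⟨_, rfl⟩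
  induction n using Nat.strong_induction_on generalizing E k with
  | _ n ihn =>
  induction k generalizing A with
  | zero =>
    refine ⟨{A}, countable_singleton _, by simp, ?_⟩
    rintro _ rfl
    refine ⟨E, inferInstance, inferInstance, inferInstance, id, _, le_rfl, by simp,
      fun x hx ↦ ⟨hx, contDiffAt_id⟩, fun F _ _ g hg x hx ↦ ?_⟩
    have := (hg x hx).1.continuousAt.tendsto
    rw [(hg x hx).2] at this
    simpa [Asymptotics.isLittleO_one_iff] using this
  | succ k ihk =>
    set A' : Set E := {x ∈ A | ∀ h : E → ℝ,
      (∀ y ∈ A, ContDiffAt ℝ (k + 1 : ℕ) h y ∧ h y = 0) → fderiv ℝ h x = 0}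
    have hA' : A' ⊆ A := fun x hx ↦ hx.1
    have hsing : HasFlatCover (k + 1) A A' :=
      (ihk A').succ hA' fun h hh x hx ↦ hx.2 h hh
    have hreg : HasFlatCover (k + 1) A (A \ A') := by
      refine (HereditarilyLindelofSpace.isLindelof (A \ A')).induction_on
        (fun s t hst ht ↦ ht.mono hst) (fun T hT h ↦ HasFlatCover.sUnion hT h) ?_
      intro a ha
      obtain ⟨h, hh, hda⟩ : ∃ h : E → ℝ,
          (∀ y ∈ A, ContDiffAt ℝ (k + 1 : ℕ) h y ∧ h y = 0) ∧ fderiv ℝ h a ≠ 0 := by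
        by_contra! hcon
        exact ha.2 ⟨ha.1, hcon⟩
      obtain ⟨φ, p, hφp⟩ := exists_local_parametrization_of_fderiv_ne_zero k.succ_ne_zero
        (hh a ha.1).1 hda
      have hdim : finrank ℝ (fderiv ℝ h a).ker < n := by
        have := Module.Dual.finrank_ker_add_one_of_ne_zero (f := (fderiv ℝ h a : E →ₗ[ℝ] ℝ))
          (by exact_mod_cast hda)
        omega
      set U := {x | h x = 0 → φ (p x) = x ∧ ContDiffAt ℝ (k + 1 : ℕ) φ (p x)}
      refine ⟨A ∩ U, inter_mem (mem_of_superset self_mem_nhdsWithin sdiff_subset)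
        (mem_nhdsWithin_of_mem_nhds hφp), ?_⟩
      have hcover : HasFlatCover (k + 1) A (φ '' (p '' (A ∩ U))) := by
        refine (ihn _ hdim (k + 1) (p '' (A ∩ U)) rfl).image k.succ_ne_zero
          (hdim.le.trans_eq hn.symm) (forall_mem_image.2 fun x hx ↦ ?_)
        obtain ⟨hx₁, hx₂⟩ := hx.2 (hh x hx.1).2
        exact ⟨hx₁.symm ▸ hx.1, hx₂⟩
      refine hcover.mono fun x hx ↦ ⟨p x, mem_image_of_mem _ hx, (hx.2 (hh x hx.1).2).1⟩
    exact (hsing.union hreg).mono fun x hx ↦ by by_cases h : x ∈ A' <;> simp [h, hx]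

/-- The **Morse-Sard theorem** for real-valued functions: the set of critical values of a `C^d`
function on a `d`-dimensional space is a null set. -/
theorem volume_image_fderiv_eq_zero {E : Type} [NormedAddCommGroup E] [NormedSpace ℝ E]
    [FiniteDimensional ℝ E] {f : E → ℝ} (hf : ContDiff ℝ (finrank ℝ E) f) :
    volume (f '' {x | fderiv ℝ f x = 0}) = 0 := by
  obtain hd | ⟨k, hk⟩ : finrank ℝ E = 0 ∨ ∃ k, finrank ℝ E = k + 1 :=
    (Nat.eq_zero_or_eq_succ_pred _).imp_right fun h ↦ ⟨_, h⟩
  · have := finrank_zero_iff.1 hd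
    exact ((toFinite _).image f).measure_zero _
  rw [hk] at hf
  obtain ⟨S, hS, hcover, hflat⟩ := hasFlatCover_self k {x | fderiv ℝ f x = 0}
  refine measure_mono_null (image_mono hcover) ?_
  rw [sUnion_eq_biUnion, image_iUnion₂, measure_biUnion_null_iff hS]
  intro t ht
  obtain ⟨K, _, _, _, ψ, B, hK, hs, hψ, hflat⟩ := hflat t ht
  refine measure_mono_null (image_mono hs) ?_
  rw [← image_comp]
  refine volume_image_eq_zero_of_isLittleO_pow k.succ_pos (hK.trans_eq hk) fun x hx ↦ ?_
  refine isLittleO_comp_sub_pow_succ (ψ := ψ) (g := f) (hψ x hx).2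
    (hf.contDiffAt.of_le (by norm_cast; omega)) (hflat _ (fderiv ℝ f) (fun y hy ↦ ⟨?_, hy⟩) x hx)
  exact (hf.fderiv_right (m := k) (by norm_cast)).contDiffAt

/-- For `f : ℝ^d → ℝ` `d`-times continuously differentiable, bounded below by `f*`,
coercive, and such that `{‖∇f‖ < η} ⊆ {f − f* < D_η}` for some `η, D_η > 0`: every
nonempty open interval `(u, v)` contains a closed subinterval `[h₁, h₂]` disjoint from
the critical values of `f`, on whose preimage (if nonempty) `‖∇f‖` has a positive
lower bound. -/
theorem exists_subinterval_avoiding_critical_values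
    {d : ℕ} (f : EuclideanSpace ℝ (Fin d) → ℝ) (fStar η Dη : ℝ)
    (hsmooth : ContDiff ℝ d f)
    (hlb : ∀ x, fStar ≤ f x)
    (hcoerc : Tendsto f (comap norm atTop) atTop)
    (hη : 0 < η) (hDη : 0 < Dη)
    (hcrit : ∀ x, ‖gradient f x‖ < η → f x - fStar < Dη) :
    ∀ u v : ℝ, u < v →
      ∃ h₁ h₂ : ℝ, h₁ < h₂ ∧ Set.Icc h₁ h₂ ⊆ Set.Ioo u v ∧
        Set.Icc h₁ h₂ ∩ (f '' {x | gradient f x = 0}) = ∅ ∧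
        ((f ⁻¹' Set.Icc h₁ h₂).Nonempty →
          ∃ δ : ℝ, 0 < δ ∧ ∀ x ∈ f ⁻¹' Set.Icc h₁ h₂, δ ≤ ‖gradient f x‖) := by
  intro u v huv
  have hgrad : ∀ x, ‖gradient f x‖ = ‖fderiv ℝ f x‖ := fun x ↦
    (InnerProductSpace.toDual ℝ _).symm.norm_map _
  have hgrad_zero : {x | gradient f x = 0} = {x | fderiv ℝ f x = 0} := by
    ext x
    rw [mem_ofPred_eq, mem_ofPred_eq, ← norm_eq_zero, hgrad, norm_eq_zero]
  have hcompact : ∀ a b : ℝ, IsCompact (f ⁻¹' Icc a b) := by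
    intro a b
    refine Metric.isCompact_of_isClosed_isBounded (isClosed_Icc.preimage hsmooth.continuous) ?_
    rw [comap_norm_atTop] at hcoerc
    exact Bornology.isBounded_def.2 <| mem_of_superset (hcoerc (Ioi_mem_atTop b))
      fun x hx hx' ↦ not_lt.2 hx'.2 hx
  have hcont : Continuous fun x ↦ ‖fderiv ℝ f x‖ := by
    rcases Nat.eq_zero_or_pos d with rfl | hd
    · exact continuous_of_discreteTopology
    · exact (hsmooth.continuous_fderiv (by exact_mod_cast hd.ne')).norm
  set V : Set ℝ := f '' (f ⁻¹' Icc u v ∩ {x | fderiv ℝ f x = 0})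
  have hV_closed : IsClosed V := by
    refine (((hcompact u v).inter_right ?_).image hsmooth.continuous).isClosed
    simpa using isClosed_eq hcont continuous_const (g := fun _ ↦ 0)
  have hV_null : volume V = 0 :=
    measure_mono_null (image_mono inter_subset_right)
      (volume_image_fderiv_eq_zero (by simpa using hsmooth))
  obtain ⟨c, hc, hcV⟩ : (Ioo u v \ V).Nonempty := by
    refine nonempty_of_measure_ne_zero (μ := volume) ?_
    rw [measure_sdiff_null hV_null]
    simpa using huv
  obtain ⟨h₁, h₂, hc', hsub⟩ := mem_nhds_iff_exists_Ioo_subset.1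
    ((isOpen_Ioo.sdiff hV_closed).mem_nhds ⟨hc, hcV⟩)
  obtain ⟨a, ha₁, ha₂⟩ := exists_between hc'.1
  obtain ⟨b, hb₁, hb₂⟩ := exists_between hc'.2
  have hIcc : Icc a b ⊆ Ioo u v \ V := (Icc_subset_Ioo ha₁ hb₂).trans hsub
  have hne : ∀ x ∈ f ⁻¹' Icc a b, fderiv ℝ f x ≠ 0 := fun x hx hx0 ↦
    (hIcc hx).2 ⟨x, ⟨Ioo_subset_Icc_self (hIcc hx).1, hx0⟩, rfl⟩
  refine ⟨a, b, ha₂.trans hb₁, hIcc.trans sdiff_subset, ?_, fun hnonempty ↦ ?_⟩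
  · rw [hgrad_zero, eq_empty_iff_forall_notMem]
    rintro _ ⟨hx, x, hx0, rfl⟩
    exact hne x hx hx0
  · obtain ⟨x, hx, hmin⟩ := (hcompact a b).exists_isMinOn hnonempty hcont.continuousOn
    exact ⟨‖fderiv ℝ f x‖, norm_pos_iff.2 (hne x hx), fun y hy ↦ (hmin hy).trans_eq (hgrad y).symm⟩
end

section
/- Let f : ℝ^d → ℝ be continuously differentiable and coercive (f(θ) → +∞ as ‖θ‖ → +∞). Let x < y be real numbers (y possibly +∞) and δ > 0, and suppose ‖∇f(θ)‖ ≥ δ for every θ with f(θ) ∈ [x, y). Then there exists z < x such that ‖∇f(θ)‖ ≥ δ/2 for every θ with f(θ) ∈ [z, x]. -/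
open Filter

/-- The sublevel sets of a continuous coercive function on a proper space are compact. -/
theorem isCompact_sublevel_of_coercive {E : Type*} [SeminormedAddCommGroup E] [ProperSpace E]
    {f : E → ℝ} (hcont : Continuous f) (hcoerc : Tendsto f (comap norm atTop) atTop) (x : ℝ) :
    IsCompact {θ | f θ ≤ x} := by
  refine Metric.isCompact_of_isClosed_isBounded (isClosed_le hcont continuous_const) ?_
  rw [comap_norm_atTop] at hcoerc
  rw [Bornology.isBounded_def]
  filter_upwards [hcoerc.eventually_gt_atTop x] with θ hθ
  simpa using hθ

/-- The gradient of a continuously differentiable function is continuous. -/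
theorem continuous_gradient_of_contDiff {E : Type*} [NormedAddCommGroup E]
    [InnerProductSpace ℝ E] [CompleteSpace E] {f : E → ℝ} (hf : ContDiff ℝ 1 f) :
    Continuous (gradient f) :=
  (InnerProductSpace.toDual ℝ E).symm.continuous.comp (hf.continuous_fderiv one_ne_zero)

/-- For `f : ℝ^d → ℝ` continuously differentiable and coercive: if `x < y` (`y : EReal`
possibly `+∞`), `δ > 0`, and `‖∇f(θ)‖ ≥ δ` whenever `f(θ) ∈ [x, y)`, then there is
`z < x` with `‖∇f(θ)‖ ≥ δ/2` whenever `f(θ) ∈ [z, x]`. -/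
theorem exists_lower_threshold_gradient_bound
    {d : ℕ} (f : EuclideanSpace ℝ (Fin d) → ℝ)
    (hsmooth : ContDiff ℝ 1 f)
    (hcoerc : Tendsto f (comap norm atTop) atTop)
    (x : ℝ) (y : EReal) (hxy : (x : EReal) < y) (δ : ℝ) (hδ : 0 < δ)
    (hbound : ∀ θ : EuclideanSpace ℝ (Fin d),
      x ≤ f θ → ((f θ : ℝ) : EReal) < y → δ ≤ ‖gradient f θ‖) :
    ∃ z : ℝ, z < x ∧ ∀ θ : EuclideanSpace ℝ (Fin d),
      z ≤ f θ → f θ ≤ x → δ / 2 ≤ ‖gradient f θ‖ := by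
  have hcompact : IsCompact ({θ | f θ ≤ x} ∩ {θ | ‖gradient f θ‖ ≤ δ / 2}) :=
    (isCompact_sublevel_of_coercive hsmooth.continuous hcoerc x).inter_right
      (isClosed_le (continuous_gradient_of_contDiff hsmooth).norm continuous_const)
  rcases Set.eq_empty_or_nonempty ({θ | f θ ≤ x} ∩ {θ | ‖gradient f θ‖ ≤ δ / 2})
    with hempty | hne
  · refine ⟨x - 1, by linarith, fun θ _ hθ => ?_⟩
    by_contra! hlt
    exact (Set.ext_iff.mp hempty θ).mp ⟨hθ, hlt.le⟩
  · obtain ⟨θ₀, ⟨hle, hgrad⟩, hmax⟩ :=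
      hcompact.exists_isMaxOn hne hsmooth.continuous.continuousOn
    simp only [Set.mem_ofPred_eq] at hle hgrad
    have hlt : f θ₀ < x := by
      refine hle.lt_of_ne fun heq => ?_
      have := hbound θ₀ heq.ge (heq ▸ hxy)
      linarith
    refine ⟨(f θ₀ + x) / 2, by linarith, fun θ hz hθ => ?_⟩
    by_contra! hsmall
    have : f θ ≤ f θ₀ := hmax ⟨hθ, hsmall.le⟩
    linarith
end
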